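/- arXiv:1509.00321 — 3 statements merged into one kernel-verified Lean document; each statement's English description precedes it below -/
import Mathlib

section
/- The cone-development map preserves the lengths of smooth curves: let β ∈ (0, π/2), let a < b, and let γ : ℝ → ℝ², γ(t) = (ρ(t), θ(t)), be continuously differentiable with ρ(t) > 0 for all t ∈ [a, b]. Then the length (total variation over [a, b]) of the space curve f ∘ γ in ℝ³ equals the length of the plane curve P ∘ γ in ℝ², where P(ρ, θ) = (ρ·cos θ, ρ·sin θ): eVariationOn (f ∘ γ) [a,b] = eVariationOn (P ∘ γ) [a,b]. -/
/-- The cone-development map for half-angle `β`, in polar coordinates, with values in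
Euclidean 3-space. -/
noncomputable def coneDev (β : ℝ) (p : ℝ × ℝ) : EuclideanSpace ℝ (Fin 3) :=
  (WithLp.equiv 2 (Fin 3 → ℝ)).symm
    ![p.1 * Real.sin β * Real.cos (p.2 / Real.sin β),
      p.1 * Real.sin β * Real.sin (p.2 / Real.sin β),
      p.1 * Real.cos β]

/-- The planar polar-coordinate map `P(ρ, θ) = (ρ cos θ, ρ sin θ)`, with values in
Euclidean 2-space. -/
noncomputable def polarMap (p : ℝ × ℝ) : EuclideanSpace ℝ (Fin 2) :=
  (WithLp.equiv 2 (Fin 2 → ℝ)).symm ![p.1 * Real.cos p.2, p.1 * Real.sin p.2]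

theorem LipschitzOnWith.variationOnFromTo_le {E : Type*} [PseudoMetricSpace E]
    {f : ℝ → E} {K : NNReal} {x y : ℝ} (hxy : x ≤ y) (hf : LipschitzOnWith K f (Set.Icc x y)) :
    variationOnFromTo f Set.univ x y ≤ K * (y - x) := by
  have h := hf.comp_eVariationOn_le (Set.mapsTo_id (Set.Icc x y))
  rw [eVariationOn_id_Icc] at h
  rw [variationOnFromTo.eq_of_le _ _ hxy, Set.univ_inter]
  refine (ENNReal.toReal_mono (by finiteness) h).trans_eq ?_
  rw [ENNReal.toReal_mul, ENNReal.toReal_ofReal (sub_nonneg.2 hxy), ENNReal.coe_toReal]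

theorem LocallyBoundedVariationOn.dist_le_variationOnFromTo {E : Type*}
    [PseudoMetricSpace E] {f : ℝ → E}
    (hf : LocallyBoundedVariationOn f Set.univ) {x y : ℝ} (hxy : x ≤ y) :
    dist (f y) (f x) ≤ variationOnFromTo f Set.univ x y := by
  rw [variationOnFromTo.eq_of_le _ _ hxy, dist_edist]
  exact ENNReal.toReal_mono (hf x y trivial trivial) <| eVariationOn.edist_le f
    ⟨trivial, Set.right_mem_Icc.2 hxy⟩ ⟨trivial, Set.left_mem_Icc.2 hxy⟩

section ArcLength

variable {E F : Type*} [NormedAddCommGroup E] [NormedSpace ℝ E]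
  [NormedAddCommGroup F] [NormedSpace ℝ F]

theorem ContDiff.locallyBoundedVariationOn {f : ℝ → E} (hf : ContDiff ℝ 1 f) (s : Set ℝ) :
    LocallyBoundedVariationOn f s := by
  intro x y _ _
  obtain ⟨K, hK⟩ :=
    hf.contDiffOn.exists_lipschitzOnWith one_ne_zero (convex_Icc x y) isCompact_Icc
  exact hK.comp_boundedVariationOn (g := id) (fun _ h => h.2)
    ((BoundedVariationOn.id_Icc x y).mono Set.inter_subset_right)

/-- The arc length of a `C¹` curve has the speed of the curve as its derivative. -/
theorem ContDiff.hasDerivAt_variationOnFromTo {f : ℝ → E} (hf : ContDiff ℝ 1 f) (a x : ℝ) :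
    HasDerivAt (variationOnFromTo f Set.univ a) ‖deriv f x‖ x := by
  have hbv := hf.locallyBoundedVariationOn Set.univ
  have hsub (u v : ℝ) : variationOnFromTo f Set.univ a v - variationOnFromTo f Set.univ a u =
      variationOnFromTo f Set.univ u v :=
    variationOnFromTo.sub_right hbv trivial trivial trivial
  have hlower (y : ℝ) (hy : y ≠ x) :
      ‖slope f x y‖ ≤ slope (variationOnFromTo f Set.univ a) x y := by
    wlog hxy : x < y generalizing x y
    · rw [slope_comm f, slope_comm (variationOnFromTo f Set.univ a)]
      exact this y x hy.symm (hy.lt_of_le (not_lt.1 hxy))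
    rw [slope_def_module, slope_def_field, hsub, norm_smul, norm_inv, Real.norm_eq_abs,
      abs_of_pos (sub_pos.2 hxy), div_eq_inv_mul, ← dist_eq_norm]
    exact mul_le_mul_of_nonneg_left (hbv.dist_le_variationOnFromTo hxy.le)
      (inv_nonneg.2 (sub_pos.2 hxy).le)
  have hupper {K : NNReal} {s : Set ℝ} (hs : s.OrdConnected) (hK : LipschitzOnWith K f s)
      {u v : ℝ} (hu : u ∈ s) (hv : v ∈ s) (huv : u ≠ v) :
      slope (variationOnFromTo f Set.univ a) u v ≤ K := by
    wlog h : u < v generalizing u v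
    · rw [slope_comm]
      exact this hv hu huv.symm (huv.symm.lt_of_le (not_lt.1 h))
    rw [slope_def_field, hsub, div_le_iff₀ (sub_pos.2 h)]
    exact (hK.mono (hs.out hu hv)).variationOnFromTo_le h.le
  have hderiv : HasDerivAt f (deriv f x) x :=
    (hf.differentiable one_ne_zero).differentiableAt.hasDerivAt
  rw [hasDerivAt_iff_tendsto_slope, tendsto_order]
  refine ⟨fun c hc => ?_, fun c hc => ?_⟩
  · filter_upwards [hderiv.tendsto_slope.norm.eventually (lt_mem_nhds hc),
      self_mem_nhdsWithin] with y hy hyx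
    exact hy.trans_le (hlower y hyx)
  · obtain ⟨K, hK, hKc⟩ := exists_between (show ‖deriv f x‖₊ < c.toNNReal from
      Real.lt_toNNReal_iff_coe_lt.2 hc)
    obtain ⟨s, hs, hLip⟩ := hf.contDiffAt.exists_lipschitzOnWith_of_nnnorm_lt K
      (show ‖fderiv ℝ f x‖₊ < K by
        rw [← NNReal.coe_lt_coe, coe_nnnorm, ← norm_deriv_eq_norm_fderiv]; exact hK)
    obtain ⟨ε, hε, hball⟩ := Metric.mem_nhds_iff.1 hs
    filter_upwards [nhdsWithin_le_nhds (Metric.ball_mem_nhds x hε), self_mem_nhdsWithin]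
      with y hy hyx
    exact (hupper (convex_ball x ε).ordConnected (hLip.mono hball) (Metric.mem_ball_self hε) hy
      (Ne.symm hyx)).trans_lt (Real.lt_toNNReal_iff_coe_lt.1 hKc)

/-- Two `C¹` curves with equal speeds have equal lengths. -/
theorem eVariationOn_Icc_eq_of_norm_deriv_eq {f : ℝ → E} {g : ℝ → F} (hf : ContDiff ℝ 1 f)
    (hg : ContDiff ℝ 1 g) (h : ∀ t, ‖deriv f t‖ = ‖deriv g t‖) (a b : ℝ) :
    eVariationOn f (Set.Icc a b) = eVariationOn g (Set.Icc a b) := by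
  rcases lt_or_ge b a with hab | hab
  · simp [Set.Icc_eq_empty_of_lt hab, eVariationOn.subsingleton]
  have hd (t : ℝ) : HasDerivAt
      (variationOnFromTo f Set.univ a - variationOnFromTo g Set.univ a) 0 t := by
    simpa [h t] using
      (hf.hasDerivAt_variationOnFromTo a t).sub (hg.hasDerivAt_variationOnFromTo a t)
  have hconst := is_const_of_deriv_eq_zero (fun t => (hd t).differentiableAt)
    (fun t => (hd t).deriv) b a
  rw [Pi.sub_apply, Pi.sub_apply, variationOnFromTo.self, variationOnFromTo.self, sub_self,
    sub_eq_zero, variationOnFromTo.eq_of_le _ _ hab, variationOnFromTo.eq_of_le _ _ hab] at hconst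
  simpa only [Set.univ_inter] using (ENNReal.toReal_eq_toReal_iff'
    (hf.locallyBoundedVariationOn Set.univ a b trivial trivial)
    (hg.locallyBoundedVariationOn Set.univ a b trivial trivial)).1 hconst

end ArcLength

theorem contDiff_coneDev (β : ℝ) : ContDiff ℝ 1 (coneDev β) := by
  rw [contDiff_euclidean]
  intro i
  fin_cases i <;> simp [coneDev] <;> fun_prop

theorem contDiff_polarMap : ContDiff ℝ 1 polarMap := by
  rw [contDiff_euclidean]
  intro i
  fin_cases i <;> simp [polarMap] <;> fun_prop

theorem EuclideanSpace.deriv_apply {ι : Type*} [Fintype ι] {f : ℝ → EuclideanSpace ℝ ι} {t : ℝ}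
    (hf : DifferentiableAt ℝ f t) (i : ι) : deriv f t i = deriv (fun s => f s i) t :=
  ((EuclideanSpace.proj i : EuclideanSpace ℝ ι →L[ℝ] ℝ).hasFDerivAt.comp_hasDerivAt t
    hf.hasDerivAt).deriv.symm

theorem norm_sq_deriv_polarMap_comp {γ : ℝ → ℝ × ℝ} {t ρ' θ' : ℝ}
    (hρ : HasDerivAt (fun s => (γ s).1) ρ' t) (hθ : HasDerivAt (fun s => (γ s).2) θ' t) :
    ‖deriv (polarMap ∘ γ) t‖ ^ 2 = ρ' ^ 2 + ((γ t).1 * θ') ^ 2 := by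
  have hd : DifferentiableAt ℝ (polarMap ∘ γ) t :=
    (contDiff_polarMap.differentiable one_ne_zero _).comp t
      (hρ.differentiableAt.prodMk hθ.differentiableAt)
  have h₀ := hρ.mul hθ.cos
  have h₁ := hρ.mul hθ.sin
  rw [EuclideanSpace.real_norm_sq_eq, Fin.sum_univ_two, EuclideanSpace.deriv_apply hd,
    EuclideanSpace.deriv_apply hd]
  erw [h₀.deriv, h₁.deriv]
  linear_combination (ρ' ^ 2 + ((γ t).1 * θ') ^ 2) * Real.sin_sq_add_cos_sq (γ t).2

theorem norm_sq_deriv_coneDev_comp {β : ℝ} (hβ : Real.sin β ≠ 0) {γ : ℝ → ℝ × ℝ} {t ρ' θ' : ℝ}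
    (hρ : HasDerivAt (fun s => (γ s).1) ρ' t) (hθ : HasDerivAt (fun s => (γ s).2) θ' t) :
    ‖deriv (coneDev β ∘ γ) t‖ ^ 2 = ρ' ^ 2 + ((γ t).1 * θ') ^ 2 := by
  have hd : DifferentiableAt ℝ (coneDev β ∘ γ) t :=
    ((contDiff_coneDev β).differentiable one_ne_zero _).comp t
      (hρ.differentiableAt.prodMk hθ.differentiableAt)
  have hθ' := hθ.div_const (Real.sin β)
  have h₀ := (hρ.mul_const (Real.sin β)).mul hθ'.cos
  have h₁ := (hρ.mul_const (Real.sin β)).mul hθ'.sin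
  have h₂ := hρ.mul_const (Real.cos β)
  rw [EuclideanSpace.real_norm_sq_eq, Fin.sum_univ_three, EuclideanSpace.deriv_apply hd,
    EuclideanSpace.deriv_apply hd, EuclideanSpace.deriv_apply hd]
  erw [h₀.deriv, h₁.deriv, h₂.deriv]
  have hcancel : Real.sin β * (θ' / Real.sin β) = θ' := mul_div_cancel₀ _ hβ
  linear_combination
    ((ρ' * Real.sin β) ^ 2 + ((γ t).1 * Real.sin β * (θ' / Real.sin β)) ^ 2) *
        Real.sin_sq_add_cos_sq ((γ t).2 / Real.sin β) +
      ρ' ^ 2 * Real.sin_sq_add_cos_sq β +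
      (γ t).1 ^ 2 * (Real.sin β * (θ' / Real.sin β) + θ') * hcancel

/-- The cone-development map preserves lengths of smooth curves: for a `C¹` curve
`γ(t) = (ρ(t), θ(t))` with `ρ(t) > 0` on `[a, b]`, the length of the space curve
`f ∘ γ` equals the length of the plane curve `P ∘ γ`. -/
theorem coneDev_preserves_length (β : ℝ) (hβ₀ : 0 < β) (hβ₁ : β < Real.pi / 2)
    (a b : ℝ) (hab : a < b) (γ : ℝ → ℝ × ℝ) (hγ : ContDiff ℝ 1 γ)
    (hρ : ∀ t ∈ Set.Icc a b, 0 < (γ t).1) :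
    eVariationOn (coneDev β ∘ γ) (Set.Icc a b) =
      eVariationOn (polarMap ∘ γ) (Set.Icc a b) := by
  refine eVariationOn_Icc_eq_of_norm_deriv_eq ((contDiff_coneDev β).comp hγ)
    (contDiff_polarMap.comp hγ) (fun t => ?_) a b
  have hsin : Real.sin β ≠ 0 := (Real.sin_pos_of_pos_of_lt_pi hβ₀ (by linarith)).ne'
  have hd : DifferentiableAt ℝ γ t := hγ.differentiable one_ne_zero t
  have hρ' := hd.fst.hasDerivAt
  have hθ' := hd.snd.hasDerivAt
  rw [← sq_eq_sq₀ (norm_nonneg _) (norm_nonneg _), norm_sq_deriv_coneDev_comp hsin hρ' hθ',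
    norm_sq_deriv_polarMap_comp hρ' hθ']
end

section
/- Lateral edges of the hemiball: let H be the convex hull in ℝ³ of the union of the full unit circle C = {(cos t, sin t, 0) : t ∈ ℝ} in the xy-plane and the unit semicircle C⁺ = {(cos t, 0, sin t) : t ∈ [0, π]} in the xz-plane. Fix θ ∈ (0, π/2) and set a(θ) = (cos θ, sin θ, 0) and b(θ) = (cos θ, 0, sin θ). Then for every (x, y, z) ∈ H one has x·cos θ + (y + z)·sin θ ≤ 1, and the set of points of H where equality holds is exactly the segment [a(θ), b(θ)]; consequently the segment [a(θ), b(θ)] is contained in the frontier (topological boundary) of H. -/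
/-- The unit circle `C = {(cos t, sin t, 0)}` in the `xy`-plane. -/
def circleXY : Set (ℝ × ℝ × ℝ) :=
  {q | ∃ t : ℝ, q = (Real.cos t, Real.sin t, 0)}

/-- The unit semicircle `C⁺ = {(cos t, 0, sin t) : t ∈ [0, π]}` in the `xz`-plane. -/
def semicircleXZ : Set (ℝ × ℝ × ℝ) :=
  {q | ∃ t ∈ Set.Icc (0 : ℝ) Real.pi, q = (Real.cos t, 0, Real.sin t)}

/-- If a linear functional is at most `c` on `s`, then its level set `c` in the convex hull of `s`
is the convex hull of its level set in `s`. -/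
theorem sep_convexHull_eq_of_le {E : Type*} [AddCommGroup E] [Module ℝ E] (f : E →ₗ[ℝ] ℝ)
    {s : Set E} {c : ℝ} (hs : ∀ x ∈ s, f x ≤ c) :
    {x ∈ convexHull ℝ s | f x = c} = convexHull ℝ {x ∈ s | f x = c} := by
  apply Set.Subset.antisymm
  · rintro x ⟨hx, hxc⟩
    have hsub : s ⊆ {x | f x ≤ c ∧ (f x = c → x ∈ convexHull ℝ {x ∈ s | f x = c})} :=
      fun y hy => ⟨hs y hy, fun h => subset_convexHull ℝ _ ⟨hy, h⟩⟩
    have hconv : Convex ℝ {x | f x ≤ c ∧ (f x = c → x ∈ convexHull ℝ {x ∈ s | f x = c})} := by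
      refine convex_iff_forall_pos.2 ?_
      rintro x ⟨hx, hx'⟩ y ⟨hy, hy'⟩ a b ha hb hab
      have hf : f (a • x + b • y) = a * f x + b * f y := by simp
      obtain rfl : b = 1 - a := by linarith
      refine ⟨by rw [hf]; nlinarith, fun h => ?_⟩
      rw [hf] at h
      exact convex_convexHull ℝ _ (hx' (by nlinarith)) (hy' (by nlinarith)) ha.le hb.le hab
    exact (convexHull_min hsub hconv hx).2 hxc
  · exact convexHull_min (fun x hx => ⟨subset_convexHull ℝ s hx.1, hx.2⟩)
      ((convex_convexHull ℝ s).inter (convex_hyperplane f.isLinear c))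

/-- A point of `s` at which a nonzero continuous linear functional attains its maximum over `s`
lies in the frontier of `s`. -/
theorem mem_frontier_of_forall_le {E : Type*} [AddCommGroup E] [Module ℝ E] [TopologicalSpace E]
    [ContinuousAdd E] [ContinuousSMul ℝ E] {f : E →L[ℝ] ℝ} (hf : f ≠ 0) {s : Set E} {x : E}
    (hx : x ∈ s) (hs : ∀ y ∈ s, f y ≤ f x) : x ∈ frontier s := by
  refine ⟨subset_closure hx, fun hint => ?_⟩
  have h : x ∈ interior (f ⁻¹' Set.Iic (f x)) := interior_mono hs hint
  rw [← (f.isOpenMap_of_ne_zero hf).preimage_interior_eq_interior_preimage f.continuous,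
    interior_Iic] at h
  exact lt_irrefl (f x) (Set.mem_Iio.1 h)

/-- The functional `(x, y, z) ↦ x cos θ + (y + z) sin θ`. -/
noncomputable def lateralFunctional (θ : ℝ) : ℝ × ℝ × ℝ →L[ℝ] ℝ :=
  (ContinuousLinearMap.toSpanSingleton ℝ (Real.cos θ)).coprod
    ((ContinuousLinearMap.toSpanSingleton ℝ (Real.sin θ)).coprod
      (ContinuousLinearMap.toSpanSingleton ℝ (Real.sin θ)))

theorem lateralFunctional_apply (θ : ℝ) (q : ℝ × ℝ × ℝ) :
    lateralFunctional θ q = q.1 * Real.cos θ + (q.2.1 + q.2.2) * Real.sin θ := by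
  simp [lateralFunctional, add_mul]

theorem lateralFunctional_ne_zero (θ : ℝ) : lateralFunctional θ ≠ 0 := by
  intro h
  have := DFunLike.congr_fun h (Real.cos θ, Real.sin θ, 0)
  rw [lateralFunctional_apply] at this
  simp only [add_zero, zero_apply] at this
  nlinarith [Real.sin_sq_add_cos_sq θ]

theorem cos_mul_cos_add_sin_mul_sin_le_one (t θ : ℝ) :
    Real.cos t * Real.cos θ + Real.sin t * Real.sin θ ≤ 1 := by
  rw [← Real.cos_sub]
  exact Real.cos_le_one _

theorem cos_eq_and_sin_eq_of_cos_mul_cos_add_sin_mul_sin_eq_one {t θ : ℝ}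
    (h : Real.cos t * Real.cos θ + Real.sin t * Real.sin θ = 1) :
    Real.cos t = Real.cos θ ∧ Real.sin t = Real.sin θ := by
  have h1 := Real.sin_sq_add_cos_sq t
  have h2 := Real.sin_sq_add_cos_sq θ
  constructor <;>
    nlinarith [sq_nonneg (Real.cos t - Real.cos θ), sq_nonneg (Real.sin t - Real.sin θ)]

theorem lateralFunctional_le_one (θ : ℝ) {q : ℝ × ℝ × ℝ} (hq : q ∈ circleXY ∪ semicircleXZ) :
    lateralFunctional θ q ≤ 1 := by
  rw [lateralFunctional_apply]
  rcases hq with ⟨t, rfl⟩ | ⟨t, -, rfl⟩ <;>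
    simpa using cos_mul_cos_add_sin_mul_sin_le_one t θ

theorem sep_lateralFunctional_eq_one {θ : ℝ} (hθ : θ ∈ Set.Icc 0 Real.pi) :
    {q ∈ circleXY ∪ semicircleXZ | lateralFunctional θ q = 1} =
      {(Real.cos θ, Real.sin θ, 0), (Real.cos θ, 0, Real.sin θ)} := by
  ext q
  simp only [lateralFunctional_apply, Set.mem_ofPred_eq, Set.mem_insert_iff,
    Set.mem_singleton_iff]
  constructor
  · rintro ⟨⟨t, rfl⟩ | ⟨t, -, rfl⟩, h⟩ <;>
    · obtain ⟨hc, hs⟩ :=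
        cos_eq_and_sin_eq_of_cos_mul_cos_add_sin_mul_sin_eq_one (t := t) (θ := θ) (by simpa using h)
      simp [hc, hs]
  · have h := Real.cos_sq_add_sin_sq θ
    rintro (rfl | rfl)
    · exact ⟨Or.inl ⟨θ, rfl⟩, by simpa [sq] using h⟩
    · exact ⟨Or.inr ⟨θ, hθ, rfl⟩, by simpa [sq] using h⟩

/-- Lateral edges of the hemiball `H = conv(C ∪ C⁺)`: for `θ ∈ (0, π/2)`, the linear
functional `(x, y, z) ↦ x cos θ + (y + z) sin θ` is at most `1` on `H`, its equality set
in `H` is exactly the segment from `a(θ) = (cos θ, sin θ, 0)` to `b(θ) = (cos θ, 0, sin θ)`,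
and hence that segment lies in the frontier of `H`. -/
theorem hemiball_lateral_edge (θ : ℝ) (hθ : θ ∈ Set.Ioo 0 (Real.pi / 2)) :
    (∀ q ∈ convexHull ℝ (circleXY ∪ semicircleXZ),
        q.1 * Real.cos θ + (q.2.1 + q.2.2) * Real.sin θ ≤ 1) ∧
    {q ∈ convexHull ℝ (circleXY ∪ semicircleXZ) |
        q.1 * Real.cos θ + (q.2.1 + q.2.2) * Real.sin θ = 1} =
      segment ℝ (Real.cos θ, Real.sin θ, 0) (Real.cos θ, 0, Real.sin θ) ∧
    segment ℝ (Real.cos θ, Real.sin θ, 0) (Real.cos θ, 0, Real.sin θ) ⊆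
      frontier (convexHull ℝ (circleXY ∪ semicircleXZ)) := by
  simp only [← lateralFunctional_apply]
  have hle : ∀ q ∈ convexHull ℝ (circleXY ∪ semicircleXZ), lateralFunctional θ q ≤ 1 :=
    convexHull_min (fun q hq => lateralFunctional_le_one θ hq)
      (convex_halfSpace_le (lateralFunctional θ).isLinear 1)
  have hface : {q ∈ convexHull ℝ (circleXY ∪ semicircleXZ) | lateralFunctional θ q = 1} =
      segment ℝ (Real.cos θ, Real.sin θ, 0) (Real.cos θ, 0, Real.sin θ) := by
    rw [← convexHull_pair, ← sep_lateralFunctional_eq_one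
      ⟨hθ.1.le, by linarith [hθ.2, Real.pi_pos]⟩]
    exact sep_convexHull_eq_of_le (lateralFunctional θ).toLinearMap
      fun q hq => lateralFunctional_le_one θ hq
  refine ⟨hle, hface, fun q hq => ?_⟩
  rw [← hface] at hq
  exact mem_frontier_of_forall_le (lateralFunctional_ne_zero θ) hq.1
    fun y hy => (hle y hy).trans_eq hq.2.symm
end

section
/- The 1-skeleton of the rhombic dodecahedron has no Hamiltonian path: let G be the simple graph on the 14-element vertex set V = (Fin 3 → Bool) ⊕ (Fin 3 × Bool) (8 'cube' vertices and 6 'octahedron' vertices) in which a cube vertex s : Fin 3 → Bool is adjacent to an octahedron vertex (i, b) ∈ Fin 3 × Bool exactly when s i = b, and there are no other adjacencies. Then there is no walk in G that is a Hamiltonian path, i.e., no walk visiting every vertex of V exactly once. -/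
/-- The edge graph (1-skeleton) of the rhombic dodecahedron: vertices are the 8 cube
vertices (sign vectors `s : Fin 3 → Bool`) and the 6 octahedron vertices (pairs
`(i, b) : Fin 3 × Bool`); a cube vertex `s` is adjacent to an octahedron vertex `(i, b)`
exactly when `s i = b`, and there are no other adjacencies. -/
def rhombicDodecahedronGraph : SimpleGraph ((Fin 3 → Bool) ⊕ (Fin 3 × Bool)) :=
  SimpleGraph.fromRel fun u v =>
    ∃ (s : Fin 3 → Bool) (i : Fin 3) (b : Bool),
      u = Sum.inl s ∧ v = Sum.inr (i, b) ∧ s i = b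

namespace SimpleGraph.Walk

variable {V : Type*} {G : SimpleGraph V}

/-- Along a walk, the vertices of an independent set are separated by vertices outside it. -/
theorem countP_support_le_of_not_adj (p : V → Prop) [DecidablePred p]
    (hp : ∀ x y, p x → p y → ¬ G.Adj x y) {u v : V} (w : G.Walk u v) :
    w.support.countP p ≤ w.support.countP (¬ p ·) + if p u then 1 else 0 := by
  induction w with
  | @nil a => by_cases ha : p a <;> simp [ha]
  | @cons a b c h w ih =>
    by_cases ha : p a
    · have hb : ¬ p b := fun hb => hp a b ha hb h
      simp_all
    · simp only [support_cons, List.countP_cons, ha]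
      split_ifs at ih <;> simp_all
      omega

theorem IsHamiltonian.countP_support [Fintype V] [DecidableEq V] {u v : V} {w : G.Walk u v}
    (hw : w.IsHamiltonian) (p : V → Prop) [DecidablePred p] :
    w.support.countP p = Fintype.card {x // p x} := by
  rw [List.countP_eq_length_filter,
    ← List.toFinset_card_of_nodup (hw.isPath.support_nodup.filter _),
    List.toFinset_filter, hw.toFinset_support, Fintype.card_subtype]
  simp

/-- In a graph with a Hamiltonian path, an independent set has at most one vertex more than
its complement. -/
theorem IsHamiltonian.card_le_card_compl_add_one [Fintype V] [DecidableEq V] {u v : V}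
    {w : G.Walk u v} (hw : w.IsHamiltonian) (p : V → Prop) [DecidablePred p]
    (hp : ∀ x y, p x → p y → ¬ G.Adj x y) :
    Fintype.card {x // p x} ≤ Fintype.card {x // ¬ p x} + 1 := by
  have h := w.countP_support_le_of_not_adj p hp
  rw [hw.countP_support p, hw.countP_support (¬ p ·)] at h
  exact h.trans (by split_ifs <;> omega)

end SimpleGraph.Walk

/-- The 1-skeleton of the rhombic dodecahedron has no Hamiltonian path. -/
theorem rhombicDodecahedron_no_hamiltonian_path :
    ¬ ∃ (u v : (Fin 3 → Bool) ⊕ (Fin 3 × Bool))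
        (w : rhombicDodecahedronGraph.Walk u v), w.IsHamiltonian := by
  rintro ⟨u, v, w, hw⟩
  have h := hw.card_le_card_compl_add_one (fun x => x.isLeft = true) (by
    rintro (s | x) (t | y) <;> simp [rhombicDodecahedronGraph])
  revert h
  decide
end
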